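/- (Steady states and convergence.) Assume (A0), let B2 be a real k2×m matrix and let u ∈ ℝ^{m} be a constant input. Then the stationary system G·x̄2 = 0, −Gᵀ·x̄1 + D·x̄2 − Nᵀ·x̄3 = B2·u, N·x̄2 = 0 has a unique solution (x̄1, x̄2, x̄3) ∈ ℝ^{k1} × ℝ^{k2} × ℝ^{k3}, and for every differentiable x1 : [0,∞) → ℝ^{k1}, differentiable x2 : [0,∞) → ℝ^{k2} and x3 : [0,∞) → ℝ^{k3} satisfying for all t ≥ 0: M1·x1'(t) + G·x2(t) = 0, M2·x2'(t) − Gᵀ·x1(t) + D·x2(t) − Nᵀ·x3(t) = B2·u and N·x2(t) = 0, one has x1(t) → x̄1 and x2(t) → x̄2 as t → ∞. -/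

import Mathlib

open Matrix Filter Topology

namespace Matrix

/-- The saddle-point operator of the stationary system. -/
def saddlePointMap {k1 k2 k3 : ℕ} (D : Matrix (Fin k2) (Fin k2) ℝ)
    (G : Matrix (Fin k1) (Fin k2) ℝ) (N : Matrix (Fin k3) (Fin k2) ℝ) :
    ((Fin k1 → ℝ) × (Fin k2 → ℝ) × (Fin k3 → ℝ)) →ₗ[ℝ]
      ((Fin k1 → ℝ) × (Fin k2 → ℝ) × (Fin k3 → ℝ)) where
  toFun x := (G *ᵥ x.2.1, -(Gᵀ *ᵥ x.1) + D *ᵥ x.2.1 - Nᵀ *ᵥ x.2.2, N *ᵥ x.2.1)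
  map_add' x y := by
    simp only [Prod.fst_add, Prod.snd_add, mulVec_add, Prod.mk_add_mk, Prod.mk.injEq, true_and,
      and_true]
    abel
  map_smul' c x := by
    simp only [Prod.smul_fst, Prod.smul_snd, mulVec_smul, RingHom.id_apply, Prod.smul_mk,
      smul_sub, smul_add, smul_neg]

theorem saddlePointMap_injective {k1 k2 k3 : ℕ} {D : Matrix (Fin k2) (Fin k2) ℝ}
    {G : Matrix (Fin k1) (Fin k2) ℝ} {N : Matrix (Fin k3) (Fin k2) ℝ} (hD : D.PosDef)
    (hGN : Function.Injective fun x : (Fin k1 → ℝ) × (Fin k3 → ℝ) => Gᵀ *ᵥ x.1 + Nᵀ *ᵥ x.2) :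
    Function.Injective (saddlePointMap D G N) := by
  rw [injective_iff_map_eq_zero]
  rintro ⟨x1, x2, x3⟩ h
  simp only [saddlePointMap, LinearMap.coe_mk, AddHom.coe_mk, Prod.mk_eq_zero] at h
  obtain ⟨hG, hE, hN⟩ := h
  have hx2 : x2 = 0 := by
    by_contra hne
    have hpos : 0 < x2 ⬝ᵥ D *ᵥ x2 := by simpa using hD.dotProduct_mulVec_pos hne
    have h0 := congrArg (fun v => x2 ⬝ᵥ v) hE
    simp only [dotProduct_sub, dotProduct_add, dotProduct_neg, dotProduct_transpose_mulVec, hG,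
      hN, dotProduct_zero] at h0
    linarith
  subst hx2
  have h0 : (x1, x3) = (0 : (Fin k1 → ℝ) × (Fin k3 → ℝ)) := by
    apply hGN
    simp only [mulVec_zero, add_zero] at hE
    simp only [Prod.fst_zero, Prod.snd_zero, mulVec_zero, add_zero]
    rw [← neg_eq_zero, ← hE]
    abel
  simp_all

theorem exists_mul_eq_one_mul_eq_zero {k1 k2 k3 : ℕ} {D : Matrix (Fin k2) (Fin k2) ℝ}
    {G : Matrix (Fin k1) (Fin k2) ℝ} {N : Matrix (Fin k3) (Fin k2) ℝ}
    (h : Function.Injective (saddlePointMap D G N)) :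
    ∃ R : Matrix (Fin k2) (Fin k1) ℝ, G * R = 1 ∧ N * R = 0 := by
  have hs := LinearMap.surjective_of_injective h
  choose f hf using fun j : Fin k1 => hs (Pi.single j 1, 0, 0)
  simp only [saddlePointMap, LinearMap.coe_mk, AddHom.coe_mk, Prod.mk.injEq] at hf
  refine ⟨of fun i j => (f j).2.1 i, ?_, ?_⟩
  · ext i j
    have := congrFun (hf j).1 i
    simpa [mul_apply, mulVec, dotProduct, one_apply, Pi.single_apply] using this
  · ext i j
    have := congrFun (hf j).2.2 i
    simpa [mul_apply, mulVec, dotProduct] using this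

theorem sq_le_dotProduct_self {n : Type*} [Fintype n] (x : n → ℝ) (i : n) :
    x i ^ 2 ≤ x ⬝ᵥ x := by
  rw [sq]
  exact Finset.single_le_sum (f := fun i => x i * x i) (fun j _ => mul_self_nonneg _)
    (Finset.mem_univ i)

theorem dotProduct_self_nonneg_real {n : Type*} [Fintype n] (x : n → ℝ) : 0 ≤ x ⬝ᵥ x :=
  Finset.sum_nonneg fun _ _ => mul_self_nonneg _

theorem two_mul_dotProduct_le {n : Type*} [Fintype n] (x y : n → ℝ) :
    2 * (x ⬝ᵥ y) ≤ x ⬝ᵥ x + y ⬝ᵥ y := by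
  have := dotProduct_self_nonneg_real (x - y)
  simp only [sub_dotProduct, dotProduct_sub, dotProduct_comm y x] at this
  linarith

theorem exists_dotProduct_mulVec_self_le {n : Type*} [Fintype n] (A : Matrix n n ℝ) :
    ∃ C : ℝ, 0 ≤ C ∧ ∀ x : n → ℝ, x ⬝ᵥ A *ᵥ x ≤ C * (x ⬝ᵥ x) := by
  refine ⟨∑ i, ∑ j, |A i j|, by positivity, fun x => ?_⟩
  rw [Finset.sum_mul]
  refine Finset.sum_le_sum fun i _ => ?_
  rw [mulVec, dotProduct, Finset.mul_sum, Finset.sum_mul]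
  refine Finset.sum_le_sum fun j _ => ?_
  have hx : |x i * x j| ≤ x ⬝ᵥ x := by
    have h1 := sq_le_dotProduct_self x i
    have h2 := sq_le_dotProduct_self x j
    rw [abs_le]
    constructor <;> nlinarith [sq_nonneg (x i + x j), sq_nonneg (x i - x j)]
  calc x i * (A i j * x j) = A i j * (x i * x j) := by ring
    _ ≤ |A i j| * |x i * x j| := (le_abs_self _).trans_eq (abs_mul _ _)
    _ ≤ |A i j| * (x ⬝ᵥ x) := mul_le_mul_of_nonneg_left hx (abs_nonneg _)

theorem exists_dotProduct_mulVec_le {m n : Type*} [Fintype m] [Fintype n] (A : Matrix m n ℝ) :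
    ∃ C : ℝ, 0 ≤ C ∧
      ∀ (x : m → ℝ) (y : n → ℝ), x ⬝ᵥ A *ᵥ y ≤ C * (x ⬝ᵥ x) + (1 / 2) * (y ⬝ᵥ y) := by
  obtain ⟨C, hC, h⟩ := exists_dotProduct_mulVec_self_le (A * Aᵀ)
  refine ⟨C, hC, fun x y => ?_⟩
  have h1 := two_mul_dotProduct_le (Aᵀ *ᵥ x) y
  have h2 : (Aᵀ *ᵥ x) ⬝ᵥ (Aᵀ *ᵥ x) = x ⬝ᵥ (A * Aᵀ) *ᵥ x := by
    rw [dotProduct_transpose_mulVec, mulVec_mulVec]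
  have h3 : (Aᵀ *ᵥ x) ⬝ᵥ y = x ⬝ᵥ A *ᵥ y := by
    rw [dotProduct_comm, dotProduct_transpose_mulVec]
  have h4 := dotProduct_self_nonneg_real x
  nlinarith [h x, mul_nonneg hC h4]

open scoped MatrixOrder Matrix.Norms.L2Operator in
theorem PosDef.exists_mul_dotProduct_self_le {n : Type*} [Fintype n]
    {A : Matrix n n ℝ} (hA : A.PosDef) :
    ∃ c : ℝ, 0 < c ∧ ∀ x : n → ℝ, c * (x ⬝ᵥ x) ≤ x ⬝ᵥ A *ᵥ x := by
  classical
  obtain ⟨B, hB⟩ := CStarAlgebra.nonneg_iff_eq_star_mul_self.mp hA.posSemidef.nonneg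
  replace hB : A = Bᵀ * B := by simpa [star_eq_conjTranspose] using hB
  have hu : IsUnit A.det := hA.det_pos.ne'.isUnit
  obtain ⟨C, hC, h⟩ := exists_dotProduct_mulVec_self_le ((A⁻¹ * Bᵀ)ᵀ * (A⁻¹ * Bᵀ))
  refine ⟨1 / (C + 1), by positivity, fun x => ?_⟩
  have hx : (A⁻¹ * Bᵀ) *ᵥ (B *ᵥ x) = x := by
    rw [mulVec_mulVec, Matrix.mul_assoc, ← hB, nonsing_inv_mul _ hu, one_mulVec]
  have h1 := h (B *ᵥ x)
  rw [← mulVec_mulVec, dotProduct_transpose_mulVec, hx] at h1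
  have h2 : x ⬝ᵥ A *ᵥ x = (B *ᵥ x) ⬝ᵥ (B *ᵥ x) := by
    conv_lhs => rw [hB, ← mulVec_mulVec, dotProduct_transpose_mulVec]
  rw [h2, one_div, inv_mul_le_iff₀ (by positivity)]
  linarith [dotProduct_self_nonneg_real (B *ᵥ x)]

theorem hasDerivAt_dotProduct_mulVec {m n : Type*} [Fintype m] [Fintype n] (A : Matrix m n ℝ)
    {f : ℝ → m → ℝ} {g : ℝ → n → ℝ} {f' : m → ℝ} {g' : n → ℝ} {t : ℝ}
    (hf : HasDerivAt f f' t) (hg : HasDerivAt g g' t) :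
    HasDerivAt (fun s => f s ⬝ᵥ A *ᵥ g s) (f' ⬝ᵥ A *ᵥ g t + f t ⬝ᵥ A *ᵥ g') t := by
  rw [hasDerivAt_pi] at hf hg
  simp only [mulVec, dotProduct, ← Finset.sum_add_distrib]
  exact HasDerivAt.fun_sum fun i _ => (hf i).mul
    (HasDerivAt.fun_sum fun j _ => (hg j).const_mul (A i j))

end Matrix

/-- A function on the nonnegative reals whose derivative is at most -c times itself decays
exponentially. -/
theorem le_mul_exp_of_hasDerivAt_le {W W' : ℝ → ℝ} {c : ℝ}
    (hW : ∀ t, 0 ≤ t → HasDerivAt W (W' t) t) (hle : ∀ t, 0 ≤ t → W' t ≤ -c * W t)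
    {t : ℝ} (ht : 0 ≤ t) : W t ≤ W 0 * Real.exp (-c * t) := by
  have hd : ∀ s, 0 ≤ s → HasDerivAt (fun s => W s * Real.exp (c * s))
      (W' s * Real.exp (c * s) + W s * (Real.exp (c * s) * c)) s := fun s hs => by
    have h1 : HasDerivAt (fun s => c * s) c s := by
      simpa using (hasDerivAt_id s).const_mul c
    exact (hW s hs).mul h1.exp
  have hanti : AntitoneOn (fun s => W s * Real.exp (c * s)) (Set.Ici 0) := by
    apply antitoneOn_of_deriv_nonpos (convex_Ici 0)
    · exact fun s hs => (hd s hs).continuousAt.continuousWithinAt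
    · intro s hs
      rw [interior_Ici] at hs
      exact (hd s hs.le).differentiableAt.differentiableWithinAt
    · intro s hs
      rw [interior_Ici] at hs
      rw [(hd s hs.le).deriv]
      nlinarith [hle s hs.le, Real.exp_pos (c * s)]
  have h := hanti (Set.self_mem_Ici) ht ht
  simp only [mul_zero, Real.exp_zero, mul_one] at h
  rw [neg_mul, Real.exp_neg, ← div_eq_mul_inv, le_div_iff₀ (Real.exp_pos _)]
  exact h

theorem tendsto_zero_of_dotProduct_self_le {n : Type*} [Fintype n] {x : ℝ → n → ℝ} {b : ℝ → ℝ}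
    (hb : Tendsto b atTop (𝓝 0)) (h : ∀ t, 0 ≤ t → x t ⬝ᵥ x t ≤ b t) :
    Tendsto x atTop (𝓝 0) := by
  rw [tendsto_pi_nhds]
  intro i
  have hsq : Tendsto (fun t => x t i ^ 2) atTop (𝓝 0) :=
    squeeze_zero' (Eventually.of_forall fun t => sq_nonneg _)
      ((eventually_ge_atTop 0).mono fun t ht => (sq_le_dotProduct_self _ i).trans (h t ht)) hb
  have h2 := hsq.sqrt
  simp only [Real.sqrt_sq_eq_abs, Real.sqrt_zero] at h2
  exact (tendsto_zero_iff_abs_tendsto_zero _).2 h2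

/-- Every solution of the homogeneous evolution system decays to zero. -/
theorem tendsto_zero_of_homogeneous {k1 k2 k3 : ℕ}
    {M1 : Matrix (Fin k1) (Fin k1) ℝ} {M2 D : Matrix (Fin k2) (Fin k2) ℝ}
    {G : Matrix (Fin k1) (Fin k2) ℝ} {N : Matrix (Fin k3) (Fin k2) ℝ}
    (hM1 : M1.PosDef) (hM2 : M2.PosDef) (hD : D.PosDef)
    {R : Matrix (Fin k2) (Fin k1) ℝ} (hGR : G * R = 1) (hNR : N * R = 0)
    {x1 x1' : ℝ → Fin k1 → ℝ} {x2 x2' : ℝ → Fin k2 → ℝ} {x3 : ℝ → Fin k3 → ℝ}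
    (hx1 : ∀ t, 0 ≤ t → HasDerivAt x1 (x1' t) t)
    (hx2 : ∀ t, 0 ≤ t → HasDerivAt x2 (x2' t) t)
    (h1 : ∀ t, 0 ≤ t → M1 *ᵥ x1' t + G *ᵥ x2 t = 0)
    (h2 : ∀ t, 0 ≤ t → M2 *ᵥ x2' t - Gᵀ *ᵥ x1 t + D *ᵥ x2 t - Nᵀ *ᵥ x3 t = 0)
    (h3 : ∀ t, 0 ≤ t → N *ᵥ x2 t = 0) :
    Tendsto x1 atTop (𝓝 0) ∧ Tendsto x2 atTop (𝓝 0) := by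
  have hM1T : M1ᵀ = M1 := by simpa using hM1.isHermitian.eq
  have hM2T : M2ᵀ = M2 := by simpa using hM2.isHermitian.eq
  obtain ⟨c1, hc1, hM1c⟩ := hM1.exists_mul_dotProduct_self_le
  obtain ⟨c2, hc2, hM2c⟩ := hM2.exists_mul_dotProduct_self_le
  obtain ⟨d, hd, hDd⟩ := hD.exists_mul_dotProduct_self_le
  obtain ⟨C1, hC1, hM1C⟩ := exists_dotProduct_mulVec_self_le M1
  obtain ⟨C2, hC2, hM2C⟩ := exists_dotProduct_mulVec_self_le M2
  obtain ⟨K, hK, hKle⟩ := exists_dotProduct_mulVec_le (M2 * R)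
  obtain ⟨P, hP, hPle⟩ := exists_dotProduct_mulVec_le (D * R)
  obtain ⟨Q, hQ, hQle⟩ := exists_dotProduct_mulVec_self_le (M2 * R * M1⁻¹ * G)
  obtain ⟨κ, hκ0, hκ1, hκ2, hκ3⟩ : ∃ κ : ℝ, 0 ≤ κ ∧ 3 / 2 ≤ κ * c1 ∧ K + 1 ≤ κ * c2 ∧
      P + Q + 1 / 2 ≤ κ * (2 * d) := by
    have hev := ((tendsto_id.atTop_mul_const hc1).eventually_ge_atTop (3 / 2)).and
      (((tendsto_id.atTop_mul_const hc2).eventually_ge_atTop (K + 1)).and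
      ((tendsto_id.atTop_mul_const (by positivity : 0 < 2 * d)).eventually_ge_atTop
        (P + Q + 1 / 2)))
    obtain ⟨κ, h0, h⟩ := ((eventually_ge_atTop (0 : ℝ)).and hev).exists
    exact ⟨κ, h0, h⟩
  have hx1eq : ∀ t, 0 ≤ t → x1' t = -(M1⁻¹ *ᵥ (G *ᵥ x2 t)) := fun t ht => by
    have hu : IsUnit M1.det := hM1.det_pos.ne'.isUnit
    rw [← mulVec_neg, ← eq_neg_of_add_eq_zero_left (h1 t ht), mulVec_mulVec,
      nonsing_inv_mul _ hu, one_mulVec]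
  have hx2eq : ∀ t, 0 ≤ t → M2 *ᵥ x2' t = Gᵀ *ᵥ x1 t - D *ᵥ x2 t + Nᵀ *ᵥ x3 t := fun t ht => by
    rw [← sub_eq_zero, ← h2 t ht]
    abel
  set W : ℝ → ℝ := fun t => κ * (x1 t ⬝ᵥ M1 *ᵥ x1 t + x2 t ⬝ᵥ M2 *ᵥ x2 t) -
    x2 t ⬝ᵥ (M2 * R) *ᵥ x1 t with hWdef
  set W' : ℝ → ℝ := fun t => -(κ * (2 * (x2 t ⬝ᵥ D *ᵥ x2 t))) - x1 t ⬝ᵥ x1 t +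
    x2 t ⬝ᵥ (D * R) *ᵥ x1 t + x2 t ⬝ᵥ (M2 * R * M1⁻¹ * G) *ᵥ x2 t with hW'def
  have hWd : ∀ t, 0 ≤ t → HasDerivAt W (W' t) t := by
    intro t ht
    have hder := (((hasDerivAt_dotProduct_mulVec M1 (hx1 t ht) (hx1 t ht)).add
      (hasDerivAt_dotProduct_mulVec M2 (hx2 t ht) (hx2 t ht))).const_mul κ).sub
      (hasDerivAt_dotProduct_mulVec (M2 * R) (hx2 t ht) (hx1 t ht))
    refine hder.congr_deriv ?_
    have e1 : x1' t ⬝ᵥ M1 *ᵥ x1 t = x1 t ⬝ᵥ M1 *ᵥ x1' t := by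
      rw [← dotProduct_transpose_mulVec, hM1T]
    have e2 : x2' t ⬝ᵥ M2 *ᵥ x2 t = x2 t ⬝ᵥ M2 *ᵥ x2' t := by
      rw [← dotProduct_transpose_mulVec, hM2T]
    have e3 : x1 t ⬝ᵥ M1 *ᵥ x1' t = -(x1 t ⬝ᵥ G *ᵥ x2 t) := by
      rw [eq_neg_of_add_eq_zero_left (h1 t ht), dotProduct_neg]
    have e4 : x2 t ⬝ᵥ M2 *ᵥ x2' t = x1 t ⬝ᵥ G *ᵥ x2 t - x2 t ⬝ᵥ D *ᵥ x2 t := by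
      rw [hx2eq t ht, dotProduct_add, dotProduct_sub, dotProduct_transpose_mulVec,
        dotProduct_transpose_mulVec, h3 t ht, dotProduct_zero, add_zero]
    have e5 : x2' t ⬝ᵥ (M2 * R) *ᵥ x1 t = x1 t ⬝ᵥ x1 t - x2 t ⬝ᵥ (D * R) *ᵥ x1 t := by
      have hDT : Dᵀ = D := by simpa using hD.isHermitian.eq
      have hNRx : N *ᵥ (R *ᵥ x1 t) = 0 := by rw [mulVec_mulVec, hNR, zero_mulVec]
      have hGRx : G *ᵥ (R *ᵥ x1 t) = x1 t := by rw [mulVec_mulVec, hGR, one_mulVec]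
      rw [← mulVec_mulVec, ← mulVec_mulVec, ← dotProduct_transpose_mulVec, hM2T, hx2eq t ht,
        dotProduct_add, dotProduct_sub, dotProduct_transpose_mulVec, dotProduct_transpose_mulVec,
        hNRx, hGRx, dotProduct_zero, add_zero, ← dotProduct_transpose_mulVec D, hDT]
    have e6 : x2 t ⬝ᵥ (M2 * R) *ᵥ x1' t = -(x2 t ⬝ᵥ (M2 * R * M1⁻¹ * G) *ᵥ x2 t) := by
      rw [hx1eq t ht, mulVec_neg, dotProduct_neg, mulVec_mulVec, mulVec_mulVec]
    rw [e1, e2, e3, e4, e5, e6]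
    ring
  have ha := fun t => dotProduct_self_nonneg_real (x1 t)
  have hb := fun t => dotProduct_self_nonneg_real (x2 t)
  have hWlow : ∀ t, x1 t ⬝ᵥ x1 t + x2 t ⬝ᵥ x2 t ≤ W t := fun t => by
    have g1 := mul_le_mul_of_nonneg_left (hM1c (x1 t)) hκ0
    have g2 := mul_le_mul_of_nonneg_left (hM2c (x2 t)) hκ0
    have g3 := hKle (x2 t) (x1 t)
    have g4 := mul_le_mul_of_nonneg_right hκ1 (ha t)
    have g5 := mul_le_mul_of_nonneg_right hκ2 (hb t)
    simp only [hWdef]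
    linarith
  obtain ⟨C, hC, hWup⟩ : ∃ C : ℝ, 0 < C ∧ ∀ t, W t ≤ C * (x1 t ⬝ᵥ x1 t + x2 t ⬝ᵥ x2 t) := by
    refine ⟨κ * C1 + κ * C2 + K + 1, by positivity, fun t => ?_⟩
    have g1 := mul_le_mul_of_nonneg_left (hM1C (x1 t)) hκ0
    have g2 := mul_le_mul_of_nonneg_left (hM2C (x2 t)) hκ0
    have g3 := hKle (x2 t) (-x1 t)
    simp only [mulVec_neg, dotProduct_neg, neg_dotProduct, neg_neg] at g3
    have g4 := mul_nonneg (mul_nonneg hκ0 hC1) (hb t)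
    have g5 := mul_nonneg (mul_nonneg hκ0 hC2) (ha t)
    have g6 := mul_nonneg hK (ha t)
    simp only [hWdef]
    linarith [ha t, hb t]
  have hW'le : ∀ t, 0 ≤ t → W' t ≤ -(1 / (2 * C)) * W t := fun t _ => by
    have g1 := mul_le_mul_of_nonneg_left (hDd (x2 t)) hκ0
    have g2 := hPle (x2 t) (x1 t)
    have g3 := hQle (x2 t)
    have g4 := mul_le_mul_of_nonneg_right hκ3 (hb t)
    have g5 : 1 / (2 * C) * W t ≤ 1 / 2 * (x1 t ⬝ᵥ x1 t + x2 t ⬝ᵥ x2 t) := by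
      refine (mul_le_mul_of_nonneg_left (hWup t) (by positivity)).trans_eq ?_
      field_simp
    have g6 : W' t ≤ -(1 / 2 * (x1 t ⬝ᵥ x1 t + x2 t ⬝ᵥ x2 t)) := by
      simp only [hW'def]
      linarith
    linarith
  have hlim : Tendsto (fun t => W 0 * Real.exp (-(1 / (2 * C)) * t)) atTop (𝓝 0) := by
    have hneg : Tendsto (fun t : ℝ => -(1 / (2 * C)) * t) atTop atBot :=
      tendsto_id.const_mul_atTop_of_neg (by simpa using hC)
    simpa using (Real.tendsto_exp_atBot.comp hneg).const_mul (W 0)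
  have hdecay := fun t (ht : 0 ≤ t) => le_mul_exp_of_hasDerivAt_le hWd hW'le ht
  exact ⟨tendsto_zero_of_dotProduct_self_le hlim fun t ht => by
      linarith [hdecay t ht, hWlow t, hb t],
    tendsto_zero_of_dotProduct_self_le hlim fun t ht => by
      linarith [hdecay t ht, hWlow t, ha t]⟩

/-- Steady states and convergence: under (A0), for any constant input u the
stationary system has a unique solution, and every solution of the evolution
system with constant input u converges to this steady state. -/
theorem steady_states_and_convergence {k1 k2 k3 m : ℕ}
    (M1 : Matrix (Fin k1) (Fin k1) ℝ) (M2 D : Matrix (Fin k2) (Fin k2) ℝ)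
    (G : Matrix (Fin k1) (Fin k2) ℝ) (N : Matrix (Fin k3) (Fin k2) ℝ)
    (B2 : Matrix (Fin k2) (Fin m) ℝ)
    (hM1 : M1.PosDef) (hM2 : M2.PosDef) (hD : D.PosDef)
    (hGN : Function.Injective fun x : (Fin k1 → ℝ) × (Fin k3 → ℝ) =>
      Gᵀ.mulVec x.1 + Nᵀ.mulVec x.2)
    (u : Fin m → ℝ) :
    ∃ xbar : (Fin k1 → ℝ) × (Fin k2 → ℝ) × (Fin k3 → ℝ),
      (G.mulVec xbar.2.1 = 0 ∧
        -(Gᵀ.mulVec xbar.1) + D.mulVec xbar.2.1 - Nᵀ.mulVec xbar.2.2 = B2.mulVec u ∧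
        N.mulVec xbar.2.1 = 0) ∧
      (∀ ybar : (Fin k1 → ℝ) × (Fin k2 → ℝ) × (Fin k3 → ℝ),
        (G.mulVec ybar.2.1 = 0 ∧
          -(Gᵀ.mulVec ybar.1) + D.mulVec ybar.2.1 - Nᵀ.mulVec ybar.2.2 = B2.mulVec u ∧
          N.mulVec ybar.2.1 = 0) → ybar = xbar) ∧
      ∀ (x1 : ℝ → Fin k1 → ℝ) (x2 : ℝ → Fin k2 → ℝ) (x3 : ℝ → Fin k3 → ℝ)
        (x1' : ℝ → Fin k1 → ℝ) (x2' : ℝ → Fin k2 → ℝ),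
        (∀ t, 0 ≤ t → HasDerivAt x1 (x1' t) t) →
        (∀ t, 0 ≤ t → HasDerivAt x2 (x2' t) t) →
        (∀ t, 0 ≤ t → M1.mulVec (x1' t) + G.mulVec (x2 t) = 0) →
        (∀ t, 0 ≤ t → M2.mulVec (x2' t) - Gᵀ.mulVec (x1 t) + D.mulVec (x2 t) -
          Nᵀ.mulVec (x3 t) = B2.mulVec u) →
        (∀ t, 0 ≤ t → N.mulVec (x2 t) = 0) →
        Tendsto x1 atTop (𝓝 xbar.1) ∧ Tendsto x2 atTop (𝓝 xbar.2.1) := by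
  have hinj := saddlePointMap_injective hD hGN
  obtain ⟨R, hGR, hNR⟩ := exists_mul_eq_one_mul_eq_zero hinj
  obtain ⟨xbar, hxbar⟩ := LinearMap.surjective_of_injective hinj (0, B2 *ᵥ u, 0)
  have hsol := hxbar
  simp only [saddlePointMap, LinearMap.coe_mk, AddHom.coe_mk, Prod.mk.injEq] at hsol
  refine ⟨xbar, hsol, fun ybar hy => hinj ?_, ?_⟩
  · rw [hxbar]
    simpa only [saddlePointMap, LinearMap.coe_mk, AddHom.coe_mk, Prod.mk.injEq] using hy
  · intro x1 x2 x3 x1' x2' hx1 hx2 h1 h2 h3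
    obtain ⟨hG, hE, hN⟩ := hsol
    have h := tendsto_zero_of_homogeneous hM1 hM2 hD hGR hNR
      (x1 := fun t => x1 t - xbar.1) (x2 := fun t => x2 t - xbar.2.1)
      (x3 := fun t => x3 t - xbar.2.2)
      (fun t ht => (hx1 t ht).sub_const _) (fun t ht => (hx2 t ht).sub_const _)
      (fun t ht => by rw [mulVec_sub, hG, sub_zero, h1 t ht])
      (fun t ht => by
        rw [mulVec_sub, mulVec_sub, mulVec_sub, ← sub_eq_zero.2 ((h2 t ht).trans hE.symm)]
        abel)
      (fun t ht => by rw [mulVec_sub, hN, sub_zero, h3 t ht])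
    exact ⟨tendsto_sub_nhds_zero_iff.1 h.1, tendsto_sub_nhds_zero_iff.1 h.2⟩
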